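/- Let M be a weight sequence satisfying the moderate growth condition. Then for every real number s ≥ 1 there is a constant κ_s ≥ 1 such that h_M(t) ≤ (h_M(κ_s t))^s for every t ≥ 0. -/

import Mathlib

open Set Filter MeasureTheory Topology

/-- A weight sequence: positive, nondecreasing, `M 0 = 1`, logarithmically convex
(the sequence of ratios `M (j+1) / M j` is nondecreasing), and `M j ^ (1/j) → ∞`. -/
def IsWeightSeq (M : ℕ → ℝ) : Prop :=
  (∀ j, 0 < M j) ∧ Monotone M ∧ M 0 = 1 ∧
  (∀ j, M (j + 1) / M j ≤ M (j + 2) / M (j + 1)) ∧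
  Tendsto (fun j : ℕ => (M j) ^ (1 / (j : ℝ))) atTop atTop

/-- The moderate growth condition. -/
def ModerateGrowth (M : ℕ → ℝ) : Prop :=
  ∃ A > 0, ∀ j k : ℕ, M (j + k) ≤ A ^ (j + k) * (M j * M k)

/-- The strong non-quasianalyticity condition. -/
def StrongNQA (M : ℕ → ℝ) : Prop :=
  ∃ A > 0, ∀ k : ℕ, ∑' j : ℕ, M (k + j) / (((k + j : ℕ) + 1) * M ((k + j) + 1))
      ≤ A * (M k / M (k + 1))

/-- The function `h_M` associated with a weight sequence. -/
noncomputable def hFun (M : ℕ → ℝ) (t : ℝ) : ℝ :=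
  if t = 0 then 0 else ⨅ j : ℕ, t ^ j * M j

theorem hFun_of_pos (M : ℕ → ℝ) {t : ℝ} (ht : 0 < t) : hFun M t = ⨅ j : ℕ, t ^ j * M j :=
  if_neg ht.ne'

theorem hFun_nonneg {M : ℕ → ℝ} (hM : ∀ j, 0 ≤ M j) {t : ℝ} (ht : 0 ≤ t) : 0 ≤ hFun M t := by
  rcases ht.eq_or_lt with rfl | ht
  · simp [hFun]
  · rw [hFun_of_pos M ht]
    exact Real.iInf_nonneg fun j => mul_nonneg (pow_nonneg ht.le j) (hM j)

theorem hFun_le {M : ℕ → ℝ} (hM : ∀ j, 0 ≤ M j) {t : ℝ} (ht : 0 < t) (j : ℕ) :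
    hFun M t ≤ t ^ j * M j := by
  rw [hFun_of_pos M ht]
  exact ciInf_le ⟨0, by rintro _ ⟨k, rfl⟩; exact mul_nonneg (pow_nonneg ht.le k) (hM k)⟩ j

theorem hFun_le_one {M : ℕ → ℝ} (hM : ∀ j, 0 ≤ M j) (h0 : M 0 = 1) {t : ℝ} (ht : 0 < t) :
    hFun M t ≤ 1 := by
  simpa [h0] using hFun_le hM ht 0

theorem hFun_le_sq {M : ℕ → ℝ} (hM : ∀ j, 0 ≤ M j) {A : ℝ} (hA : 0 < A)
    (h : ∀ j k : ℕ, M (j + k) ≤ A ^ (j + k) * (M j * M k)) {t : ℝ} (ht : 0 < t) :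
    hFun M t ≤ hFun M (A * t) ^ 2 := by
  have hAt : 0 < A * t := mul_pos hA ht
  rw [sq]
  nth_rewrite 2 [hFun_of_pos M hAt]
  rw [Real.mul_iInf_of_nonneg (hFun_nonneg hM hAt.le)]
  refine le_ciInf fun k => ?_
  rw [hFun_of_pos M hAt,
    Real.iInf_mul_of_nonneg (mul_nonneg (pow_nonneg hAt.le k) (hM k))]
  refine le_ciInf fun j => ?_
  calc hFun M t ≤ t ^ (j + k) * M (j + k) := hFun_le hM ht _
    _ ≤ t ^ (j + k) * (A ^ (j + k) * (M j * M k)) := by gcongr; exact h j k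
    _ = (A * t) ^ j * M j * ((A * t) ^ k * M k) := by ring

theorem hFun_le_pow_two_pow {M : ℕ → ℝ} (hM : ∀ j, 0 ≤ M j) {A : ℝ} (hA : 0 < A)
    (h : ∀ j k : ℕ, M (j + k) ≤ A ^ (j + k) * (M j * M k)) {t : ℝ} (ht : 0 < t) (n : ℕ) :
    hFun M t ≤ hFun M (A ^ n * t) ^ 2 ^ n := by
  induction n with
  | zero => simp
  | succ n ih =>
    have hpos : 0 < A ^ n * t := mul_pos (pow_pos hA n) ht
    calc hFun M t ≤ hFun M (A ^ n * t) ^ 2 ^ n := ih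
      _ ≤ (hFun M (A * (A ^ n * t)) ^ 2) ^ 2 ^ n :=
        pow_le_pow_left₀ (hFun_nonneg hM hpos.le) (hFun_le_sq hM hA h hpos) _
      _ = hFun M (A ^ (n + 1) * t) ^ 2 ^ (n + 1) := by
        rw [← pow_mul, ← pow_succ', ← mul_assoc, ← pow_succ']

/-- If `M` has moderate growth, then for every `s ≥ 1` there is `κ_s ≥ 1` with
`h_M(t) ≤ (h_M(κ_s t))^s` for all `t ≥ 0`. -/
theorem hFun_moderate_growth_power
    (M : ℕ → ℝ) (hM : IsWeightSeq M) (hMG : ModerateGrowth M) :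
    ∀ s : ℝ, 1 ≤ s → ∃ κ : ℝ, 1 ≤ κ ∧ ∀ t : ℝ, 0 ≤ t →
      hFun M t ≤ (hFun M (κ * t)) ^ s := by
  intro s hs
  obtain ⟨hpos, -, h0, -, -⟩ := hM
  obtain ⟨A, hA, hAM⟩ := hMG
  have hM' : ∀ j, 0 ≤ M j := fun j => (hpos j).le
  have hB : 1 ≤ max A 1 := le_max_right A 1
  have hBM : ∀ j k : ℕ, M (j + k) ≤ max A 1 ^ (j + k) * (M j * M k) := fun j k =>
    (hAM j k).trans <| mul_le_mul_of_nonneg_right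
      (pow_le_pow_left₀ hA.le (le_max_left A 1) _) (mul_nonneg (hM' j) (hM' k))
  obtain ⟨n, hn⟩ := pow_unbounded_of_one_lt s one_lt_two
  refine ⟨max A 1 ^ n, one_le_pow₀ hB, fun t ht => ?_⟩
  rcases ht.eq_or_lt with rfl | ht
  · simp [hFun, Real.zero_rpow (zero_lt_one.trans_le hs).ne']
  have hBt : 0 < max A 1 ^ n * t := mul_pos (pow_pos (zero_lt_one.trans_le hB) n) ht
  refine (hFun_le_pow_two_pow hM' (zero_lt_one.trans_le hB) hBM ht n).trans ?_
  rw [← Real.rpow_natCast]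
  refine Real.rpow_le_rpow_of_exponent_ge_of_imp (hFun_nonneg hM' hBt.le)
    (hFun_le_one hM' h0 hBt) ?_ fun _ h => absurd h (by positivity)
  exact_mod_cast hn.le
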